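/- arXiv:1210.8424 — 2 statements merged into one kernel-verified Lean document; each statement's English description precedes it below -/
import Mathlib

section
/- If G is a 3-free digraph on n vertices, then the number of directed 4-vertex paths in G is at most (4/75)·n^4. -/
/-- A digraph is 3-free: no directed cycles of length 1, 2 or 3. -/
def ThreeFree {V : Type*} (E : V → V → Prop) : Prop :=
  (∀ v, ¬ E v v) ∧ (∀ u v, ¬ (E u v ∧ E v u)) ∧
    ∀ u v w, ¬ (E u v ∧ E v w ∧ E w u)

/-- `(u, w, v)` is an induced directed 3-vertex path. -/
def InducedP3 {V : Type*} (E : V → V → Prop) (u w v : V) : Prop :=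
  u ≠ w ∧ w ≠ v ∧ u ≠ v ∧ E u w ∧ E w v ∧ ¬ E w u ∧ ¬ E v w ∧ ¬ E u v ∧ ¬ E v u

instance {V : Type*} [DecidableEq V] (E : V → V → Prop) [DecidableRel E] (u w v : V) :
    Decidable (InducedP3 E u w v) := by unfold InducedP3; infer_instance

/-- `w, x, y, z` form a directed 4-vertex path. -/
def IsPath4 {V : Type*} (E : V → V → Prop) (w x y z : V) : Prop :=
  w ≠ x ∧ w ≠ y ∧ w ≠ z ∧ x ≠ y ∧ x ≠ z ∧ y ≠ z ∧ E w x ∧ E x y ∧ E y z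

instance {V : Type*} [DecidableEq V] (E : V → V → Prop) [DecidableRel E] (w x y z : V) :
    Decidable (IsPath4 E w x y z) := by unfold IsPath4; infer_instance

/-- `w → x → y → z → w` is a directed 4-cycle. -/
def IsCycle4 {V : Type*} (E : V → V → Prop) (w x y z : V) : Prop :=
  w ≠ x ∧ w ≠ y ∧ w ≠ z ∧ x ≠ y ∧ x ≠ z ∧ y ≠ z ∧ E w x ∧ E x y ∧ E y z ∧ E z w

instance {V : Type*} [DecidableEq V] (E : V → V → Prop) [DecidableRel E] (w x y z : V) :
    Decidable (IsCycle4 E w x y z) := by unfold IsCycle4; infer_instance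

/-- The number of induced 3-vertex directed paths. -/
def p3Count (n : ℕ) (E : Fin n → Fin n → Prop) [DecidableRel E] : ℕ :=
  ((Finset.univ : Finset (Fin n × Fin n × Fin n)).filter
    (fun p => InducedP3 E p.1 p.2.1 p.2.2)).card

/-- The number of directed 4-vertex paths. -/
def p4Count (n : ℕ) (E : Fin n → Fin n → Prop) [DecidableRel E] : ℕ :=
  ((Finset.univ : Finset (Fin n × Fin n × Fin n × Fin n)).filter
    (fun p => IsPath4 E p.1 p.2.1 p.2.2.1 p.2.2.2)).card

/-- `S`: the number of ordered 4-tuples of distinct vertices whose vertex set carries a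
directed 4-cycle; equal to 24 times the number of directed 4-cycles of `G`. -/
def sCount (n : ℕ) (E : Fin n → Fin n → Prop) [DecidableRel E] : ℕ :=
  ((Finset.univ : Finset (Fin n × Fin n × Fin n × Fin n)).filter
    (fun p => p.1 ≠ p.2.1 ∧ p.1 ≠ p.2.2.1 ∧ p.1 ≠ p.2.2.2 ∧ p.2.1 ≠ p.2.2.1 ∧
      p.2.1 ≠ p.2.2.2 ∧ p.2.2.1 ≠ p.2.2.2 ∧
      ∃ w x y z : Fin n, IsCycle4 E w x y z ∧
        ({w, x, y, z} : Finset (Fin n)) = {p.1, p.2.1, p.2.2.1, p.2.2.2})).card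

/-- `|N|`: the number of ordered 4-tuples of vertices (repetitions allowed) whose vertex
set is not the vertex set of any directed 4-vertex path. -/
def nCount (n : ℕ) (E : Fin n → Fin n → Prop) [DecidableRel E] : ℕ :=
  ((Finset.univ : Finset (Fin n × Fin n × Fin n × Fin n)).filter
    (fun p => ¬ ∃ w x y z : Fin n, IsPath4 E w x y z ∧
        ({w, x, y, z} : Finset (Fin n)) = {p.1, p.2.1, p.2.2.1, p.2.2.2})).card

open Finset

/-- Indicator of the edge relation. -/
def edgeInd {V : Type*} (E : V → V → Prop) [DecidableRel E] (u v : V) : ℚ :=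
  if E u v then 1 else 0

/-- Indicator of a closed directed walk of length four. -/
def cycleInd {V : Type*} (E : V → V → Prop) [DecidableRel E] (u w v z : V) : ℚ :=
  edgeInd E u w * edgeInd E w v * edgeInd E v z * edgeInd E z u

/-- Indicator of a directed walk with three edges. -/
def walkInd {V : Type*} (E : V → V → Prop) [DecidableRel E] (w x y z : V) : ℚ :=
  edgeInd E w x * edgeInd E x y * edgeInd E y z

/-- Indicator of an induced directed 3-vertex path (in a 2-free digraph). -/
def inducedInd {V : Type*} (E : V → V → Prop) [DecidableRel E] (u w v : V) : ℚ :=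
  edgeInd E u w * edgeInd E w v * (1 - edgeInd E u v) * (1 - edgeInd E v u)

/-- The number of directed walks of length two from `u` to `v`. -/
def midCount {V : Type*} [Fintype V] (E : V → V → Prop) [DecidableRel E] (u v : V) : ℚ :=
  ∑ w, edgeInd E u w * edgeInd E w v

/-- `x` is the midpoint of a directed walk of length two between `u` and `v`, in some direction. -/
def IsMid {V : Type*} (E : V → V → Prop) (u v x : V) : Prop :=
  (E u x ∧ E x v) ∨ (E v x ∧ E x u)

/-- All four vertices are midpoints between some `u` and `v`, and `w`, `z` in different
directions. -/
def Separated {V : Type*} (E : V → V → Prop) (w z x y : V) : Prop :=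
  ∃ u v, (E u w ∧ E w v) ∧ (E v z ∧ E z u) ∧ IsMid E u v x ∧ IsMid E u v y

theorem sum_ite_le_one_of_disjoint {p q r s : Prop} [Decidable p] [Decidable q] [Decidable r]
    [Decidable s] (pq : ¬(p ∧ q)) (pr : ¬(p ∧ r)) (ps : ¬(p ∧ s)) (qr : ¬(q ∧ r))
    (qs : ¬(q ∧ s)) (rs : ¬(r ∧ s)) :
    (((if p then (1 : ℚ) else 0) + if q then 1 else 0) + if r then 1 else 0) +
      (if s then 1 else 0) ≤ 1 := by
  split_ifs <;> first | (exfalso; tauto) | norm_num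

/-- The relation on four points with given off-diagonal values. -/
def relOfEntries (a a' b b' c c' d d' f f' g g' : Bool) : Fin 4 → Fin 4 → Bool :=
  ![![false, a, b, d], ![a', false, c, f], ![b', c', false, g], ![d', f', g', false]]

/-- Four times the number of Hamiltonian paths exceeds three times the number of (rooted)
Hamiltonian cycles by at most four. -/
def FewHamPaths (e : Fin 4 → Fin 4 → Bool) : Prop :=
  4 * #{σ : Equiv.Perm (Fin 4) | e (σ 0) (σ 1) ∧ e (σ 1) (σ 2) ∧ e (σ 2) (σ 3)}
    ≤ 4 + 3 * #{σ : Equiv.Perm (Fin 4) |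
      e (σ 0) (σ 1) ∧ e (σ 1) (σ 2) ∧ e (σ 2) (σ 3) ∧ e (σ 3) (σ 0)}

instance : DecidablePred FewHamPaths := fun _ => Nat.decLe _ _

set_option synthInstance.maxSize 1000 in
set_option synthInstance.maxHeartbeats 400000 in
theorem fewHamPaths_relOfEntries :
    ∀ a a' : Bool, ¬(a ∧ a') → ∀ b b' : Bool, ¬(b ∧ b') → ∀ c c' : Bool, ¬(c ∧ c') →
      ¬(a ∧ c ∧ b') → ¬(b ∧ c' ∧ a') → ∀ d d' : Bool, ¬(d ∧ d') → ∀ f f' : Bool, ¬(f ∧ f') →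
      ¬(a ∧ f ∧ d') → ¬(d ∧ f' ∧ a') → ∀ g g' : Bool, ¬(g ∧ g') →
      ¬(b ∧ g ∧ d') → ¬(d ∧ g' ∧ b') → ¬(c ∧ g ∧ f') → ¬(f ∧ g' ∧ c') →
      FewHamPaths (relOfEntries a a' b b' c c' d d' f f' g g') := by
  decide +kernel

theorem fewHamPaths_of_threeFree (e : Fin 4 → Fin 4 → Bool) (h1 : ∀ i, ¬ e i i)
    (h2 : ∀ i j, ¬(e i j ∧ e j i)) (h3 : ∀ i j k, ¬(e i j ∧ e j k ∧ e k i)) :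
    FewHamPaths e := by
  have key := fewHamPaths_relOfEntries (e 0 1) (e 1 0) (h2 _ _) (e 0 2) (e 2 0) (h2 _ _)
    (e 1 2) (e 2 1) (h2 _ _) (h3 _ _ _) (h3 _ _ _) (e 0 3) (e 3 0) (h2 _ _)
    (e 1 3) (e 3 1) (h2 _ _) (h3 _ _ _) (h3 _ _ _) (e 2 3) (e 3 2) (h2 _ _)
    (h3 _ _ _) (h3 _ _ _) (h3 _ _ _) (h3 _ _ _)
  convert key
  ext i j
  fin_cases i <;> fin_cases j <;> simp [relOfEntries, h1]

section General

variable {V : Type*} (E : V → V → Prop) [DecidableRel E]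

theorem edgeInd_nonneg (u v : V) : 0 ≤ edgeInd E u v := by
  unfold edgeInd; split_ifs <;> norm_num

theorem cycleInd_nonneg (u w v z : V) : 0 ≤ cycleInd E u w v z := by
  have := edgeInd_nonneg E
  unfold cycleInd
  exact mul_nonneg (mul_nonneg (mul_nonneg (this _ _) (this _ _)) (this _ _)) (this _ _)

theorem inducedInd_symm_le (h3 : ThreeFree E) (w x y : V) :
    let F : V → V → V → ℚ := fun w x y =>
      2 * (edgeInd E w x + edgeInd E x w) * (1 - (edgeInd E w y + edgeInd E y w))
        - 3 / 2 * (edgeInd E w x * edgeInd E w y + edgeInd E x w * edgeInd E y w)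
        + 6 * (edgeInd E x w * edgeInd E w y) - 10 * inducedInd E x w y
    0 ≤ F w x y + F w y x + F x w y + F x y w + F y w x + F y x w := by
  have b1 := h3.2.2 w x y
  have b2 := h3.2.2 w y x
  have orient : ∀ a b, (E a b ∧ ¬ E b a) ∨ (¬ E a b ∧ E b a) ∨ (¬ E a b ∧ ¬ E b a) := by
    intro a b
    have := h3.2.1 a b
    tauto
  rcases orient w x with ⟨c1, c2⟩ | ⟨c1, c2⟩ | ⟨c1, c2⟩ <;>
    rcases orient w y with ⟨c3, c4⟩ | ⟨c3, c4⟩ | ⟨c3, c4⟩ <;>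
    rcases orient x y with ⟨c5, c6⟩ | ⟨c5, c6⟩ | ⟨c5, c6⟩ <;>
    first
    | exact (b1 ⟨c1, c5, c4⟩).elim
    | exact (b2 ⟨c3, c6, c2⟩).elim
    | (simp only [inducedInd, edgeInd, c1, c2, c3, c4, c5, c6, if_true, if_false]; norm_num)

theorem cycleInd_eq_inducedInd_mul (h3 : ThreeFree E) (u w v z : V) :
    cycleInd E u w v z = inducedInd E u w v * (edgeInd E v z * edgeInd E z u) := by
  have t1 := h3.2.2 u v z
  have t2 := h3.2.2 u w v
  unfold cycleInd inducedInd edgeInd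
  by_cases c1 : E u w <;> by_cases c2 : E w v <;> by_cases c3 : E v z <;> by_cases c4 : E z u <;>
    by_cases c5 : E u v <;> by_cases c6 : E v u <;>
    first
    | (exfalso; tauto)
    | simp [c1, c2, c3, c4, c5, c6]

/-- A separated quadruple carries no directed walk through all its vertices. -/
theorem Separated.not_walk {E : V → V → Prop} (h3 : ThreeFree E) {q : Fin 4 → V}
    (hq : Separated E (q 0) (q 1) (q 2) (q 3)) (σ : Equiv.Perm (Fin 4)) :
    ¬ (E (q (σ 0)) (q (σ 1)) ∧ E (q (σ 1)) (q (σ 2)) ∧ E (q (σ 2)) (q (σ 3))) := by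
  obtain ⟨u, v, ⟨h0, h0'⟩, ⟨h1, h1'⟩, h2, h4⟩ := hq
  rintro ⟨e1, e2, e3⟩
  have hmid : ∀ i, IsMid E u v (q i) := by
    intro i
    fin_cases i
    exacts [Or.inl ⟨h0, h0'⟩, Or.inr ⟨h1, h1'⟩, h2, h4]
  have step : ∀ i j, E (q i) (q j) → (E u (q i) ↔ E u (q j)) := by
    intro i j hij
    have t1 := h3.2.2 (q i) (q j) u
    have t2 := h3.2.2 (q i) (q j) v
    have t3 := h3.2.1 u (q i)
    have t4 := h3.2.1 u (q j)
    have := hmid i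
    have := hmid j
    unfold IsMid at *
    tauto
  have s1 := step _ _ e1
  have s2 := step _ _ e2
  have s3 := step _ _ e3
  have all : ∀ i, E u (q (σ i)) ↔ E u (q (σ 0)) := by
    intro i
    fin_cases i
    exacts [Iff.rfl, s1.symm, (s1.trans s2).symm, (s1.trans (s2.trans s3)).symm]
  have a0 := all (σ.symm 0)
  have a1 := all (σ.symm 1)
  rw [Equiv.apply_symm_apply] at a0 a1
  exact h3.2.1 _ _ ⟨a1.2 (a0.1 h0), h1'⟩

theorem isPath4_iff {E : V → V → Prop} (h3 : ThreeFree E) (w x y z : V) :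
    IsPath4 E w x y z ↔ E w x ∧ E x y ∧ E y z := by
  refine ⟨fun h => h.2.2.2.2.2.2, fun ⟨a, b, c⟩ => ⟨?_, ?_, ?_, ?_, ?_, ?_, a, b, c⟩⟩ <;> rintro rfl
  exacts [h3.1 _ a, h3.2.1 _ _ ⟨a, b⟩, h3.2.2 _ _ _ ⟨a, b, c⟩, h3.1 _ b, h3.2.1 _ _ ⟨b, c⟩,
    h3.1 _ c]

open Classical in
theorem sum_perm_walkInd_le (h3 : ThreeFree E) (q : Fin 4 → V) :
    4 * ∑ σ : Equiv.Perm (Fin 4), walkInd E (q (σ 0)) (q (σ 1)) (q (σ 2)) (q (σ 3))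
      ≤ 4 * (1 - if Separated E (q 0) (q 1) (q 2) (q 3) then (1 : ℚ) else 0)
        + 3 * ∑ σ : Equiv.Perm (Fin 4), cycleInd E (q (σ 0)) (q (σ 1)) (q (σ 2)) (q (σ 3)) := by
  have hc : 0 ≤ ∑ σ : Equiv.Perm (Fin 4),
      cycleInd E (q (σ 0)) (q (σ 1)) (q (σ 2)) (q (σ 3)) :=
    sum_nonneg fun σ _ => cycleInd_nonneg E _ _ _ _
  split_ifs with hs
  · have : ∀ σ : Equiv.Perm (Fin 4),
        walkInd E (q (σ 0)) (q (σ 1)) (q (σ 2)) (q (σ 3)) = 0 := by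
      intro σ
      have := hs.not_walk h3 σ
      simp only [walkInd, edgeInd, ite_zero_mul_ite_zero]
      rw [if_neg]; tauto
    simp only [this, sum_const_zero]
    linarith
  · have key := fewHamPaths_of_threeFree (fun i j => decide (E (q i) (q j)))
      (by simpa using fun i => h3.1 (q i))
      (by simpa using fun i j h => fun h' => h3.2.1 (q i) (q j) ⟨h, h'⟩)
      (by simpa using fun i j k h h' h'' => h3.2.2 (q i) (q j) (q k) ⟨h, h', h''⟩)
    simp only [FewHamPaths, decide_eq_true_eq] at key
    rw [← Nat.cast_le (α := ℚ)] at key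
    push_cast at key
    simp only [walkInd, cycleInd, edgeInd, ite_zero_mul_ite_zero, mul_one, sum_boole, and_assoc]
    simpa using key

end General

section Counting

variable {V : Type*} [Fintype V] (E : V → V → Prop) [DecidableRel E]

theorem sum_perm_three (F : V → V → V → ℚ) :
    ∑ w, ∑ x, ∑ y, (F w x y + F w y x + F x w y + F x y w + F y w x + F y x w)
      = 6 * ∑ w, ∑ x, ∑ y, F w x y := by
  have swap12 : ∀ G : V → V → V → ℚ, ∑ w, ∑ x, ∑ y, G x w y = ∑ w, ∑ x, ∑ y, G w x y :=
    fun G => sum_comm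
  have swap23 : ∀ G : V → V → V → ℚ, ∑ w, ∑ x, ∑ y, G w y x = ∑ w, ∑ x, ∑ y, G w x y :=
    fun G => sum_congr rfl fun w _ => sum_comm
  simp only [sum_add_distrib]
  have e1 := swap23 F
  have e2 := swap12 F
  have e3 := swap23 (fun a b c => F b a c)
  have e4 := swap12 (fun a b c => F a c b)
  have e5 := swap12 (fun a b c => F c a b)
  linarith

/-- Bondy's bound on induced 3-vertex paths. -/
theorem sum_inducedInd_le (h3 : ThreeFree E) :
    ∑ u, ∑ w, ∑ v, inducedInd E u w v ≤ 2 / 25 * (Fintype.card V : ℚ) ^ 3 := by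
  set F : V → V → V → ℚ := fun w x y =>
    2 * (edgeInd E w x + edgeInd E x w) * (1 - (edgeInd E w y + edgeInd E y w))
      - 3 / 2 * (edgeInd E w x * edgeInd E w y + edgeInd E x w * edgeInd E y w)
      + 6 * (edgeInd E x w * edgeInd E w y) - 10 * inducedInd E x w y with hF
  have h0 : 0 ≤ ∑ w, ∑ x, ∑ y, F w x y := by
    have := sum_perm_three F
    have h : 0 ≤ ∑ w, ∑ x, ∑ y, (F w x y + F w y x + F x w y + F x y w + F y w x + F y x w) :=
      sum_nonneg fun w _ => sum_nonneg fun x _ => sum_nonneg fun y _ =>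
        inducedInd_symm_le E h3 w x y
    linarith
  have hvertex : ∀ w, ∑ x, ∑ y, F w x y
      ≤ 4 / 5 * (Fintype.card V : ℚ) ^ 2 - 10 * ∑ x, ∑ y, inducedInd E x w y := by
    intro w
    set p := ∑ x, edgeInd E w x with hp
    set q := ∑ x, edgeInd E x w with hq
    have : ∑ x, ∑ y, F w x y = 2 * (p + q) * (Fintype.card V - (p + q))
        - 3 / 2 * (p * p + q * q) + 6 * (q * p) - 10 * ∑ x, ∑ y, inducedInd E x w y := by
      simp only [hF, sum_add_distrib, sum_sub_distrib, ← mul_sum, ← sum_mul, sum_const,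
        card_univ, nsmul_eq_mul, mul_one, ← hp, ← hq]
    rw [this]
    nlinarith [sq_nonneg (p - q), sq_nonneg (p + q - 4 / 5 * (Fintype.card V : ℚ))]
  have h1 := sum_le_sum fun w (_ : w ∈ univ) => hvertex w
  rw [sum_sub_distrib, sum_const, card_univ, nsmul_eq_mul, ← mul_sum,
    sum_comm (f := fun w x => ∑ y, inducedInd E x w y)] at h1
  linarith

theorem sum_cycleInd_rotate (f : V → V → V → V → ℚ) :
    ∑ u, ∑ w, ∑ v, ∑ z, cycleInd E u w v z * f w v z u
      = ∑ u, ∑ w, ∑ v, ∑ z, cycleInd E u w v z * f u w v z := by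
  have h : ∀ u w v z, cycleInd E u w v z = cycleInd E w v z u := by
    intros; unfold cycleInd; ring
  rw [sum_comm]
  refine sum_congr rfl fun w _ => ?_
  rw [sum_comm]
  refine sum_congr rfl fun v _ => ?_
  rw [sum_comm]
  refine sum_congr rfl fun z _ => sum_congr rfl fun u _ => ?_
  rw [h]

theorem sum_midpoints_le (h3 : ThreeFree E) (u w v z : V) :
    cycleInd E u w v z * (midCount E v u + midCount E z w + midCount E u v + midCount E w z)
      ≤ cycleInd E u w v z * Fintype.card V := by
  by_cases hc : E u w ∧ E w v ∧ E v z ∧ E z u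
  · refine mul_le_mul_of_nonneg_left ?_ (cycleInd_nonneg E _ _ _ _)
    have : (Fintype.card V : ℚ) = ∑ x : V, 1 := by simp
    rw [this]
    simp only [midCount, ← sum_add_distrib]
    refine sum_le_sum fun x _ => ?_
    obtain ⟨-, h2, h3⟩ := h3
    obtain ⟨c1, c2, c3, c4⟩ := hc
    have n12 : ¬((E v x ∧ E x u) ∧ (E z x ∧ E x w)) := fun h => h3 w v x ⟨c2, h.1.1, h.2.2⟩
    have n13 : ¬((E v x ∧ E x u) ∧ (E u x ∧ E x v)) := fun h => h2 v x ⟨h.1.1, h.2.2⟩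
    have n14 : ¬((E v x ∧ E x u) ∧ (E w x ∧ E x z)) := fun h => h3 u w x ⟨c1, h.2.1, h.1.2⟩
    have n23 : ¬((E z x ∧ E x w) ∧ (E u x ∧ E x v)) := fun h => h3 v z x ⟨c3, h.1.1, h.2.2⟩
    have n24 : ¬((E z x ∧ E x w) ∧ (E w x ∧ E x z)) := fun h => h2 w x ⟨h.2.1, h.1.2⟩
    have n34 : ¬((E u x ∧ E x v) ∧ (E w x ∧ E x z)) := fun h => h3 z u x ⟨c4, h.1.1, h.2.2⟩
    simp only [edgeInd, ite_zero_mul_ite_zero, mul_one]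
    exact sum_ite_le_one_of_disjoint n12 n13 n14 n23 n24 n34
  · have : cycleInd E u w v z = 0 := by
      simp only [cycleInd, edgeInd, ite_zero_mul_ite_zero]
      rw [if_neg]; tauto
    simp [this]

theorem sum_cycleInd_le (h3 : ThreeFree E) :
    4 * ∑ u, ∑ w, ∑ v, ∑ z, cycleInd E u w v z
      ≤ Fintype.card V * ∑ u, ∑ w, ∑ v, inducedInd E u w v := by
  set H := ∑ u, ∑ w, ∑ v, ∑ z, cycleInd E u w v z with hH
  set T := ∑ u, ∑ w, ∑ v, inducedInd E u w v with hT
  set K := ∑ u, ∑ w, ∑ v, inducedInd E u w v * midCount E v u ^ 2 with hK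
  have hi : ∀ u w v, inducedInd E u w v = 0 ∨ inducedInd E u w v = 1 := by
    intro u w v
    unfold inducedInd edgeInd
    split_ifs <;> simp
  have hH' : H = ∑ u, ∑ w, ∑ v, inducedInd E u w v * midCount E v u := by
    simp only [hH, cycleInd_eq_inducedInd_mul E h3, ← mul_sum, midCount]
  have hK' : K = ∑ u, ∑ w, ∑ v, ∑ z, cycleInd E u w v z * midCount E v u := by
    simp only [hK, cycleInd_eq_inducedInd_mul E h3, ← mul_sum, ← sum_mul]
    refine sum_congr rfl fun u _ => sum_congr rfl fun w _ => sum_congr rfl fun v _ => ?_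
    rw [← midCount]; ring
  have h4K : 4 * K ≤ Fintype.card V * H := by
    have r1 := sum_cycleInd_rotate E (fun u w v z => midCount E v u)
    have r2 := sum_cycleInd_rotate E (fun u w v z => midCount E z w)
    have r3 := sum_cycleInd_rotate E (fun u w v z => midCount E u v)
    have key := sum_le_sum fun u (_ : u ∈ univ) => sum_le_sum fun w (_ : w ∈ univ) =>
      sum_le_sum fun v (_ : v ∈ univ) => sum_le_sum fun z (_ : z ∈ univ) =>
        sum_midpoints_le E h3 u w v z
    simp only [mul_add, sum_add_distrib, ← sum_mul] at key
    simp only [← sum_mul] at r1 r2 r3 hK'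
    rw [← hH] at key
    linarith
  have hT0 : 0 ≤ T := sum_nonneg fun u _ => sum_nonneg fun w _ => sum_nonneg fun v _ => by
    rcases hi u w v with h | h <;> simp [h]
  have hH0 : 0 ≤ H := sum_nonneg fun u _ => sum_nonneg fun w _ => sum_nonneg fun v _ =>
    sum_nonneg fun z _ => cycleInd_nonneg E u w v z
  have hCS : H ^ 2 ≤ T * K := by
    rw [hH', hT, hK]
    simp only [← Fintype.sum_prod_type']
    have := sum_mul_sq_le_sq_mul_sq (univ : Finset (V × V × V))
      (fun p => inducedInd E p.1 p.2.1 p.2.2)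
      (fun p => inducedInd E p.1 p.2.1 p.2.2 * midCount E p.2.2 p.1)
    refine le_trans (le_of_eq ?_) (this.trans (le_of_eq ?_))
    · congr 1
      refine sum_congr rfl fun p _ => ?_
      rcases hi p.1 p.2.1 p.2.2 with h | h <;> simp [h]
    · congr 1 <;> refine sum_congr rfl fun p _ => ?_ <;>
        rcases hi p.1 p.2.1 p.2.2 with h | h <;> simp [h]
  rcases hH0.eq_or_lt with h | h
  · rw [← h]; simpa using mul_nonneg (Nat.cast_nonneg _) hT0
  · have : H * (4 * H) ≤ H * (Fintype.card V * T) := by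
      nlinarith [mul_le_mul_of_nonneg_left h4K hT0]
    exact le_of_mul_le_mul_left this h

open Classical in
theorem sum_cycleInd_le_sum_separated (h3 : ThreeFree E) :
    4 * ∑ u, ∑ w, ∑ v, ∑ z, cycleInd E u w v z
      ≤ ∑ w, ∑ z, ∑ x, ∑ y, (if Separated E w z x y then (1 : ℚ) else 0) := by
  set r : V → V → ℚ := fun u v => midCount E u v * midCount E v u with hr
  set g : V → V → V → ℚ := fun u v x =>
    edgeInd E u x * edgeInd E x v + edgeInd E v x * edgeInd E x u with hg
  have rsymm : ∀ u v, r u v = r v u := fun u v => mul_comm _ _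
  have mid0 : ∀ u v, 0 ≤ midCount E u v := fun u v => sum_nonneg fun w _ =>
    mul_nonneg (edgeInd_nonneg E _ _) (edgeInd_nonneg E _ _)
  have r0 : ∀ u v, 0 ≤ r u v := fun u v => mul_nonneg (mid0 _ _) (mid0 _ _)
  have gind : ∀ u v x, g u v x = if IsMid E u v x then 1 else 0 := by
    intro u v x
    have := h3.2.1 u x
    simp only [hg, edgeInd, ite_zero_mul_ite_zero, IsMid]
    by_cases a : E u x ∧ E x v <;> by_cases b : E v x ∧ E x u
    · exfalso; tauto
    all_goals simp [a, b]
  have gsum : ∀ u v, ∑ x, g u v x = midCount E u v + midCount E v u := by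
    intro u v
    simp only [hg, sum_add_distrib, midCount]
  have csum : ∀ w z, ∑ u, ∑ v, cycleInd E u w v z = r w z := by
    intro w z
    simp only [hr, midCount, cycleInd, sum_mul_sum]
    rw [sum_comm]
    refine sum_congr rfl fun u _ => sum_congr rfl fun v _ => ?_
    ring
  have rpos : ∀ u w v z, cycleInd E u w v z ≠ 0 → 0 < r w z := by
    intro u w v z hc
    rw [← csum]
    have hpos := lt_of_le_of_ne (cycleInd_nonneg E u w v z) hc.symm
    refine lt_of_lt_of_le hpos ?_
    refine le_trans ?_ (single_le_sum (f := fun u => ∑ v, cycleInd E u w v z)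
      (fun a _ => sum_nonneg fun b _ => cycleInd_nonneg E _ _ _ _) (mem_univ u))
    exact single_le_sum (f := fun v => cycleInd E u w v z)
      (fun b _ => cycleInd_nonneg E _ _ _ _) (mem_univ v)
  have hmult : ∀ w z x y, (∑ u, ∑ v, cycleInd E u w v z * (g u v x * g u v y)) / r w z
      ≤ if Separated E w z x y then (1 : ℚ) else 0 := by
    intro w z x y
    refine div_le_of_le_mul₀ (r0 _ _) (by split_ifs <;> norm_num) ?_
    rw [← csum, mul_sum]
    refine sum_le_sum fun u _ => ?_
    rw [mul_sum]
    refine sum_le_sum fun v _ => ?_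
    rw [mul_comm]
    by_cases hc : (E u w ∧ E w v) ∧ (E v z ∧ E z u) ∧ IsMid E u v x ∧ IsMid E u v y
    · rw [if_pos ⟨u, v, hc⟩, gind, gind, if_pos hc.2.2.1, if_pos hc.2.2.2, mul_one]
    · have : g u v x * g u v y * cycleInd E u w v z = 0 := by
        rw [gind, gind]
        simp only [cycleInd, edgeInd, ite_zero_mul_ite_zero]
        simp only [← and_assoc] at hc ⊢
        rw [if_neg]; tauto
      rw [this]
      exact mul_nonneg (by split_ifs <;> norm_num) (cycleInd_nonneg E _ _ _ _)
  have hsum := sum_le_sum fun w (_ : w ∈ univ) => sum_le_sum fun z (_ : z ∈ univ) =>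
      sum_le_sum fun x (_ : x ∈ univ) => sum_le_sum fun y (_ : y ∈ univ) => hmult w z x y
  refine le_trans ?_ hsum
  have hL : ∑ w, ∑ z, ∑ x, ∑ y, (∑ u, ∑ v, cycleInd E u w v z * (g u v x * g u v y)) / r w z
      = ∑ u, ∑ w, ∑ v, ∑ z,
        cycleInd E u w v z * ((midCount E u v + midCount E v u) ^ 2 / r w z) := by
    have inner : ∀ w z, ∑ x, ∑ y, (∑ u, ∑ v, cycleInd E u w v z * (g u v x * g u v y)) / r w z
        = ∑ u, ∑ v, cycleInd E u w v z * ((midCount E u v + midCount E v u) ^ 2 / r w z) := by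
      intro w z
      simp only [sum_div]
      rw [sum_congr rfl fun x _ => sum_comm, sum_comm]
      refine sum_congr rfl fun u _ => ?_
      rw [sum_congr rfl fun x _ => sum_comm, sum_comm]
      refine sum_congr rfl fun v _ => ?_
      rw [← gsum, sq, sum_mul_sum, sum_div, mul_sum]
      refine sum_congr rfl fun x _ => ?_
      rw [sum_div, mul_sum]
      refine sum_congr rfl fun y _ => ?_
      ring
    simp only [inner]
    rw [sum_congr rfl fun w _ => sum_comm, sum_comm]
    refine sum_congr rfl fun u _ => sum_congr rfl fun w _ => sum_comm
  rw [hL]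
  have hX : ∑ u, ∑ w, ∑ v, ∑ z, cycleInd E u w v z
      ≤ ∑ u, ∑ w, ∑ v, ∑ z, cycleInd E u w v z * (r u v / r w z) := by
    have rot := sum_cycleInd_rotate E (fun u w v z => r u v / r w z)
    have pt : ∀ u w v z, 2 * cycleInd E u w v z
        ≤ cycleInd E u w v z * (r u v / r w z) + cycleInd E u w v z * (r w z / r v u) := by
      intro u w v z
      by_cases hc : cycleInd E u w v z = 0
      · simp [hc]
      · have p1 := rpos u w v z hc
        have hc' : cycleInd E w v z u ≠ 0 := by
          intro h; apply hc; rw [← h]; unfold cycleInd; ring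
        have p2 := rpos w v z u hc'
        rw [rsymm u v, ← mul_add, mul_comm]
        refine mul_le_mul_of_nonneg_left ?_ (cycleInd_nonneg E _ _ _ _)
        rw [div_add_div _ _ p1.ne' p2.ne', le_div_iff₀ (mul_pos p1 p2)]
        nlinarith [sq_nonneg (r v u - r w z)]
    have := sum_le_sum fun u (_ : u ∈ univ) => sum_le_sum fun w (_ : w ∈ univ) =>
      sum_le_sum fun v (_ : v ∈ univ) => sum_le_sum fun z (_ : z ∈ univ) => pt u w v z
    simp only [sum_add_distrib, ← mul_sum] at this rot ⊢
    linarith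
  have hY : 4 * ∑ u, ∑ w, ∑ v, ∑ z, cycleInd E u w v z * (r u v / r w z)
      ≤ ∑ u, ∑ w, ∑ v, ∑ z,
        cycleInd E u w v z * ((midCount E u v + midCount E v u) ^ 2 / r w z) := by
    simp only [mul_sum]
    refine sum_le_sum fun u _ => sum_le_sum fun w _ => sum_le_sum fun v _ =>
      sum_le_sum fun z _ => ?_
    rw [mul_left_comm, ← mul_div_assoc]
    refine mul_le_mul_of_nonneg_left ?_ (cycleInd_nonneg E _ _ _ _)
    refine div_le_div_of_nonneg_right ?_ (r0 _ _)
    simp only [hr]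
    nlinarith [sq_nonneg (midCount E u v - midCount E v u)]
  linarith

theorem sum_fun_fin_four (F : V → V → V → V → ℚ) :
    ∑ q : Fin 4 → V, F (q 0) (q 1) (q 2) (q 3) = ∑ w, ∑ x, ∑ y, ∑ z, F w x y z := by
  let φ : (Fin 4 → V) ≃ V × V × V × V :=
    { toFun := fun q => (q 0, q 1, q 2, q 3)
      invFun := fun t => ![t.1, t.2.1, t.2.2.1, t.2.2.2]
      left_inv := fun q => by
        ext i
        fin_cases i <;> rfl
      right_inv := fun _ => rfl }
  simp only [← Fintype.sum_prod_type']
  exact Fintype.sum_equiv φ _ _ fun _ => rfl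

theorem sum_perm_four (F : V → V → V → V → ℚ) :
    ∑ q : Fin 4 → V, ∑ σ : Equiv.Perm (Fin 4), F (q (σ 0)) (q (σ 1)) (q (σ 2)) (q (σ 3))
      = 24 * ∑ w, ∑ x, ∑ y, ∑ z, F w x y z := by
  have h : ∀ σ : Equiv.Perm (Fin 4),
      ∑ q : Fin 4 → V, F (q (σ 0)) (q (σ 1)) (q (σ 2)) (q (σ 3))
        = ∑ w, ∑ x, ∑ y, ∑ z, F w x y z := by
    intro σ
    rw [← sum_fun_fin_four]
    exact Fintype.sum_equiv (Equiv.arrowCongr σ.symm (Equiv.refl V)) _ _ fun q => by simp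
  rw [sum_comm]
  simp only [h, sum_const, card_univ, Fintype.card_perm, Fintype.card_fin, nsmul_eq_mul]
  norm_num [Nat.factorial]

theorem sum_walkInd_le (h3 : ThreeFree E) :
    ∑ w, ∑ x, ∑ y, ∑ z, walkInd E w x y z ≤ 4 / 75 * (Fintype.card V : ℚ) ^ 4 := by
  classical
  have h := sum_le_sum fun q (_ : q ∈ univ) => sum_perm_walkInd_le E h3 q
  simp only [sum_add_distrib, ← mul_sum, sum_sub_distrib, sum_perm_four] at h
  rw [sum_fun_fin_four (fun w z x y => if Separated E w z x y then (1 : ℚ) else 0)] at h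
  simp only [sum_const, card_univ, Fintype.card_fun, Fintype.card_fin, nsmul_eq_mul, mul_one,
    Nat.cast_pow] at h
  have hS := sum_cycleInd_le_sum_separated E h3
  have hC := sum_cycleInd_le E h3
  have hT := mul_le_mul_of_nonneg_left (sum_inducedInd_le E h3)
    (Nat.cast_nonneg (α := ℚ) (Fintype.card V))
  have hpow : (Fintype.card V : ℚ) * (2 / 25 * (Fintype.card V : ℚ) ^ 3)
      = 2 / 25 * (Fintype.card V : ℚ) ^ 4 := by ring
  linarith

end Counting

theorem p4_bound (n : ℕ) (E : Fin n → Fin n → Prop) [DecidableRel E]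
    (h3 : ThreeFree E) :
    (p4Count n E : ℚ) ≤ 4 / 75 * (n : ℚ) ^ 4 := by
  have hcount : (p4Count n E : ℚ) = ∑ w, ∑ x, ∑ y, ∑ z, walkInd E w x y z := by
    simp only [p4Count, isPath4_iff h3, walkInd, edgeInd, ite_zero_mul_ite_zero, mul_one,
      card_filter, Nat.cast_sum, Fintype.sum_prod_type, Nat.cast_ite, Nat.cast_one,
      Nat.cast_zero, and_assoc]
  rw [hcount]
  simpa using sum_walkInd_le E h3
end

section
/- Let G be a 2-free circular interval digraph on n ≥ 4 vertices that is optimal (maximizes the number of induced 3-vertex paths, and subject to that minimizes ξ(G)). Then G has no stable set of size 3; i.e., there do not exist three pairwise nonadjacent vertices. -/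
/-- A digraph (given by its edge relation) is 2-free: no loops and no 2-cycles. -/
def TwoFree {V : Type*} (E : V → V → Prop) : Prop :=
  (∀ v, ¬ E v v) ∧ ∀ u v, ¬ (E u v ∧ E v u)

/-- The clockwise circular distance (the "length" of the pair `(u,v)`) on `Fin n`. -/
def cdist (n : ℕ) (u v : Fin n) : ℕ := ((v : ℕ) + n - (u : ℕ)) % n

/-- `E` is a circular interval digraph with respect to the standard circular order of
`Fin n`: whenever `u, v, w` are distinct and in clockwise order (i.e. `v` lies strictly
between `u` and `w` clockwise) and `u → w` is an edge, then `u → v` and `v → w` are edges. -/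
def CircInterval (n : ℕ) (E : Fin n → Fin n → Prop) : Prop :=
  ∀ u v w : Fin n, u ≠ v → v ≠ w → u ≠ w →
    cdist n u v < cdist n u w → E u w → E u v ∧ E v w

/-- `ξ(G)`: the number of pairs (edge `uv`, non-edge `wx`) with `d(u,v) > d(w,x)`. -/
def xiCount (n : ℕ) (E : Fin n → Fin n → Prop) [DecidableRel E] : ℕ :=
  ((Finset.univ : Finset (Fin n × Fin n × Fin n × Fin n)).filter
    (fun p => E p.1 p.2.1 ∧ p.2.2.1 ≠ p.2.2.2 ∧ ¬ E p.2.2.1 p.2.2.2 ∧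
      ¬ E p.2.2.2 p.2.2.1 ∧ cdist n p.2.2.1 p.2.2.2 < cdist n p.1 p.2.1)).card

/-- `E` is optimal: it is a 2-free circular interval digraph on `n` vertices maximizing
the number of induced 3-vertex paths, and subject to that minimizing `ξ`. -/
def Optimal (n : ℕ) (E : Fin n → Fin n → Prop) [DecidableRel E] : Prop :=
  TwoFree E ∧ CircInterval n E ∧
    ∀ (F : Fin n → Fin n → Prop) (instF : DecidableRel F), TwoFree F → CircInterval n F →
      @p3Count n F instF ≤ p3Count n E ∧
        (@p3Count n F instF = p3Count n E → xiCount n E ≤ @xiCount n F instF)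

section CircularDistance

variable {n : ℕ}

/-- Circular distances computed from the positions seen from a base point `o`. -/
theorem cdist_rebase (o u v : Fin n) :
    cdist n o u < n ∧ cdist n o v < n ∧
      ((cdist n o u ≤ cdist n o v ∧ cdist n u v + cdist n o u = cdist n o v) ∨
        (cdist n o v < cdist n o u ∧ cdist n u v + cdist n o u = cdist n o v + n)) := by
  have key : ∀ a b : Fin n, ((a : ℕ) ≤ b ∧ cdist n a b + a = b) ∨
      ((b : ℕ) < a ∧ cdist n a b + a = b + n) := by
    intro a b
    have ha := a.isLt
    have hb := b.isLt
    unfold cdist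
    rcases le_or_gt (a : ℕ) b with h | h
    · left
      have h1 : (b : ℕ) + n - a = (b - a) + n := by omega
      rw [h1, Nat.add_mod_right, Nat.mod_eq_of_lt (by omega)]
      omega
    · right
      rw [Nat.mod_eq_of_lt (by omega)]
      omega
  have h1 := key o u
  have h2 := key o v
  have h3 := key u v
  have := o.isLt
  have := u.isLt
  have := v.isLt
  omega

theorem cdist_eq_zero {u v : Fin n} : cdist n u v = 0 ↔ u = v := by
  have := cdist_rebase v u v
  have hv := cdist_rebase v v v
  constructor
  · intro h
    have hu := u.isLt
    have hv := v.isLt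
    unfold cdist at h
    have hd := Nat.dvd_of_mod_eq_zero h
    obtain ⟨k, hk⟩ := hd
    have hk1 : k = 1 := by
      rcases k with _ | _ | k
      · omega
      · rfl
      · have : n * (k + 1 + 1) = n * k + n + n := by ring
        omega
    subst hk1
    ext
    omega
  · rintro rfl
    omega

theorem cdist_pos {u v : Fin n} : 0 < cdist n u v ↔ u ≠ v := by
  rw [Nat.pos_iff_ne_zero, Ne, cdist_eq_zero]

theorem cdist_right_injective (u : Fin n) : Function.Injective (cdist n u) := by
  intro v w h
  have := cdist_rebase u v w
  exact cdist_eq_zero.1 (by omega)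

theorem exists_cdist_eq (u : Fin n) {k : ℕ} (hk : k < n) : ∃ v, cdist n u v = k := by
  refine ⟨⟨(u + k) % n, Nat.mod_lt _ (by omega)⟩, ?_⟩
  have hu := u.isLt
  unfold cdist
  rcases lt_or_ge ((u : ℕ) + k) n with h | h
  · simp only [Nat.mod_eq_of_lt h]
    rw [show (u : ℕ) + k + n - u = k + n by omega, Nat.add_mod_right, Nat.mod_eq_of_lt hk]
  · have h1 : ((u : ℕ) + k) % n = u + k - n := by
      rw [Nat.mod_eq_sub_mod h, Nat.mod_eq_of_lt (by omega)]
    simp only [h1]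
    rw [show (u : ℕ) + k - n + n - u = k by omega, Nat.mod_eq_of_lt hk]

theorem CircInterval.split {E : Fin n → Fin n → Prop} (h : CircInterval n E) {u v w : Fin n}
    (huw : E u w) (h0 : 0 < cdist n u v) (h1 : cdist n u v < cdist n u w) : E u v ∧ E v w :=
  h u v w (cdist_pos.1 h0) (by rintro rfl; exact lt_irrefl _ h1)
    (cdist_pos.1 (h0.trans h1)) h1 huw

end CircularDistance

/-- `s, p, q` is a stable triple listed in clockwise order. -/
structure StableTriple (n : ℕ) (E : Fin n → Fin n → Prop) (s p q : Fin n) : Prop where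
  pos : 0 < cdist n p q
  lt : cdist n p q < cdist n p s
  not_sp : ¬ E s p
  not_ps : ¬ E p s
  not_pq : ¬ E p q
  not_qp : ¬ E q p
  not_qs : ¬ E q s
  not_sq : ¬ E s q

/-- The digraph obtained by adding the edge `p → q`. -/
def addEdge {V : Type*} (E : V → V → Prop) (p q a b : V) : Prop := E a b ∨ (a = p ∧ b = q)

instance {V : Type*} [DecidableEq V] (E : V → V → Prop) [DecidableRel E] (p q : V) :
    DecidableRel (addEdge E p q) := fun a b => by unfold addEdge; infer_instance

namespace StableTriple

variable {n : ℕ} {E : Fin n → Fin n → Prop} {s p q : Fin n}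

theorem rotate (h : StableTriple n E s p q) : StableTriple n E p q s := by
  have h1 := cdist_rebase p q s
  have h2 := cdist_rebase p q p
  have h3 := h.pos
  have h4 := h.lt
  have h5 := cdist_eq_zero.2 (rfl : p = p)
  exact ⟨by omega, by omega, h.not_pq, h.not_qp, h.not_qs, h.not_sq, h.not_sp, h.not_ps⟩

theorem of_not_adj_left (hC : CircInterval n E) (h : StableTriple n E s p q) {x : Fin n}
    (h0 : 0 < cdist n p x) (h1 : cdist n p x < cdist n p q) (hx : ¬ E x q) :
    StableTriple n E s x q := by
  have a1 := cdist_rebase p x q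
  have a2 := cdist_rebase p x s
  have a3 := cdist_rebase p s x
  have a4 := cdist_rebase p q x
  have a5 := cdist_rebase p s p
  have a6 := cdist_rebase p q s
  have a7 := cdist_eq_zero.2 (rfl : p = p)
  have h3 := h.lt
  exact ⟨by omega, by omega,
    fun e => h.not_sp (hC.split e (v := p) (by omega) (by omega)).1,
    fun e => h.not_qs (hC.split e (v := q) (by omega) (by omega)).2, hx,
    fun e => h.not_qs (hC.split e (v := s) (by omega) (by omega)).1, h.not_qs, h.not_sq⟩

theorem of_not_adj_right (hC : CircInterval n E) (h : StableTriple n E s p q) {x : Fin n}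
    (h0 : 0 < cdist n p x) (h1 : cdist n p x < cdist n p q) (hx : ¬ E p x) :
    StableTriple n E s p x := by
  have a2 := cdist_rebase p x s
  have a3 := cdist_rebase p s x
  have a4 := cdist_rebase p x q
  have a5 := cdist_rebase p s p
  have a6 := cdist_rebase p x p
  have a7 := cdist_eq_zero.2 (rfl : p = p)
  have h3 := h.lt
  exact ⟨h0, by omega, h.not_sp, h.not_ps, hx,
    fun e => h.not_sp (hC.split e (v := s) (by omega) (by omega)).2,
    fun e => h.not_qs (hC.split e (v := q) (by omega) (by omega)).2,
    fun e => h.not_sp (hC.split e (v := p) (by omega) (by omega)).1⟩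

/-- A clockwise stable triple whose gap from `p` to `q` is minimum among all stable triples. -/
def IsMin (n : ℕ) (E : Fin n → Fin n → Prop) (s p q : Fin n) : Prop :=
  StableTriple n E s p q ∧
    ∀ s' p' q', StableTriple n E s' p' q' → cdist n p q ≤ cdist n p' q'

theorem exists_isMin (h : StableTriple n E s p q) : ∃ s' p' q', IsMin n E s' p' q' := by
  classical
  have hex : ∃ d s p q, StableTriple n E s p q ∧ cdist n p q = d := ⟨_, s, p, q, h, rfl⟩
  obtain ⟨s', p', q', h', hd⟩ := Nat.find_spec hex
  refine ⟨s', p', q', h', fun s'' p'' q'' h'' => ?_⟩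
  rw [hd]
  exact Nat.find_min' hex ⟨s'', p'', q'', h'', rfl⟩

theorem exists_clockwise {u v w : Fin n} (huv : u ≠ v) (huw : u ≠ w) (hvw : v ≠ w)
    (h1 : ¬ E u v) (h2 : ¬ E v u) (h3 : ¬ E u w) (h4 : ¬ E w u) (h5 : ¬ E v w) (h6 : ¬ E w v) :
    ∃ s p q, StableTriple n E s p q := by
  rcases lt_trichotomy (cdist n u v) (cdist n u w) with h | h | h
  · exact ⟨w, u, v, cdist_pos.2 huv, h, h4, h3, h1, h2, h5, h6⟩
  · exact absurd (cdist_right_injective u h) hvw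
  · exact ⟨v, u, w, cdist_pos.2 huw, h, h2, h1, h3, h4, h6, h5⟩

namespace IsMin

theorem adj_of_mem_gap (hC : CircInterval n E) (h : IsMin n E s p q) {x : Fin n}
    (h0 : 0 < cdist n p x) (h1 : cdist n p x < cdist n p q) : E p x ∧ E x q := by
  constructor <;> by_contra hx
  · have := h.2 _ _ _ (h.1.of_not_adj_right hC h0 h1 hx)
    omega
  · have := h.2 _ _ _ (h.1.of_not_adj_left hC h0 h1 hx)
    have := cdist_rebase p x q
    omega

theorem adj_of_dist_lt (hC : CircInterval n E) (h : IsMin n E s p q) {x : Fin n}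
    (h0 : 0 < cdist n q x) (h1 : cdist n q x < cdist n p q) : E q x := by
  by_contra hx
  have h2 := h.2 _ _ _ h.1.rotate
  have := h.2 _ _ _ (h.1.rotate.of_not_adj_right hC h0 (by omega) hx)
  omega

theorem adj_of_dist_lt' (hC : CircInterval n E) (h : IsMin n E s p q) {x : Fin n}
    (h0 : 0 < cdist n x p) (h1 : cdist n x p < cdist n p q) : E x p := by
  by_contra hx
  have h2 := h.2 _ _ _ h.1.rotate.rotate
  have a1 := cdist_rebase s x p
  have a2 := cdist_rebase s x s
  have a3 := cdist_eq_zero.2 (rfl : s = s)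
  have := h.2 _ _ _ (h.1.rotate.rotate.of_not_adj_left hC (x := x) (by omega) (by omega) hx)
  omega

theorem ne (h : IsMin n E s p q) : p ≠ q := cdist_pos.1 h.1.pos

theorem not_path (hC : CircInterval n E) (h : IsMin n E s p q) {b : Fin n} (h1 : E q b)
    (h2 : E b p) : False := by
  have hr := h.1.rotate
  have a1 := cdist_rebase q b s
  have a2 := cdist_rebase q b p
  have h3 := hr.pos
  have h4 := hr.lt
  rcases lt_trichotomy (cdist n q s) (cdist n q b) with hb | hb | hb
  · exact h.1.not_qs (hC.split h1 h3 hb).1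
  · exact h.1.not_qs (cdist_right_injective q hb ▸ h1)
  · exact h.1.not_sp (hC.split h2 (v := s) (by omega) (by omega)).2

theorem twoFree_addEdge (hT : TwoFree E) (h : IsMin n E s p q) : TwoFree (addEdge E p q) := by
  refine ⟨?_, ?_⟩
  · rintro v (e | ⟨rfl, rfl⟩)
    · exact hT.1 v e
    · exact h.ne rfl
  · rintro u v ⟨e | ⟨rfl, rfl⟩, e' | ⟨h1, h2⟩⟩
    · exact hT.2 u v ⟨e, e'⟩
    · subst h1 h2
      exact h.1.not_qp e
    · exact h.1.not_qp e'
    · exact h.ne h2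

theorem circInterval_addEdge (hC : CircInterval n E) (h : IsMin n E s p q) :
    CircInterval n (addEdge E p q) := by
  rintro u v w huv hvw huw hlt (e | ⟨rfl, rfl⟩)
  · have := hC u v w huv hvw huw hlt e
    exact ⟨Or.inl this.1, Or.inl this.2⟩
  · have := h.adj_of_mem_gap hC (cdist_pos.2 huv) hlt
    exact ⟨Or.inl this.1, Or.inl this.2⟩

theorem inducedP3_addEdge_of_ne (hC : CircInterval n E) (h : IsMin n E s p q) {a b c : Fin n}
    (hP : InducedP3 E a b c) (hne : ¬ (a = p ∧ c = q)) : InducedP3 (addEdge E p q) a b c := by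
  obtain ⟨h1, h2, h3, h4, h5, h6, h7, h8, h9⟩ := hP
  refine ⟨h1, h2, h3, Or.inl h4, Or.inl h5, ?_, ?_, ?_, ?_⟩
  · rintro (e | ⟨rfl, rfl⟩)
    exacts [h6 e, h.1.not_qp h4]
  · rintro (e | ⟨rfl, rfl⟩)
    exacts [h7 e, h.1.not_qp h5]
  · rintro (e | e)
    exacts [h8 e, hne e]
  · rintro (e | ⟨rfl, rfl⟩)
    exacts [h9 e, h.not_path hC h4 h5]

theorem inducedP3_addEdge_right (hT : TwoFree E) (hC : CircInterval n E) (h : IsMin n E s p q)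
    {w : Fin n} (hw : E q w) : InducedP3 (addEdge E p q) p q w := by
  have hqw : q ≠ w := by rintro rfl; exact hT.1 _ hw
  have hpw : p ≠ w := by rintro rfl; exact h.1.not_qp hw
  refine ⟨h.ne, hqw, hpw, Or.inr ⟨rfl, rfl⟩, Or.inl hw, ?_, ?_, ?_, ?_⟩
  · rintro (e | ⟨-, e⟩)
    exacts [h.1.not_qp e, h.ne e]
  · rintro (e | ⟨e, -⟩)
    exacts [hT.2 _ _ ⟨hw, e⟩, hpw e.symm]
  · rintro (e | ⟨-, e⟩)
    · rcases lt_trichotomy (cdist n p q) (cdist n p w) with hb | hb | hb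
      · exact h.1.not_pq (hC.split e h.1.pos hb).1
      · exact hqw (cdist_right_injective p hb)
      · exact hT.2 _ _ ⟨hw, (h.adj_of_mem_gap hC (cdist_pos.2 hpw) hb).2⟩
    · exact hqw e.symm
  · rintro (e | ⟨e, -⟩)
    exacts [h.not_path hC hw e, hpw e.symm]

theorem inducedP3_addEdge_left (hT : TwoFree E) (hC : CircInterval n E) (h : IsMin n E s p q)
    {w : Fin n} (hw : E w p) : InducedP3 (addEdge E p q) w p q := by
  have hwp : w ≠ p := by rintro rfl; exact hT.1 _ hw
  have hwq : w ≠ q := by rintro rfl; exact h.1.not_qp hw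
  refine ⟨hwp, h.ne, hwq, Or.inl hw, Or.inr ⟨rfl, rfl⟩, ?_, ?_, ?_, ?_⟩
  · rintro (e | ⟨-, e⟩)
    exacts [hT.2 _ _ ⟨hw, e⟩, hwq e]
  · rintro (e | ⟨-, e⟩)
    exacts [h.1.not_qp e, h.ne e]
  · rintro (e | ⟨e, -⟩)
    · rcases lt_trichotomy (cdist n p w) (cdist n p q) with hb | hb | hb
      · exact hT.2 _ _ ⟨hw, (h.adj_of_mem_gap hC (cdist_pos.2 hwp.symm) hb).1⟩
      · exact hwq (cdist_right_injective p hb)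
      · have a1 := cdist_rebase p w q
        have a2 := cdist_rebase p w p
        have a3 := cdist_eq_zero.2 (rfl : p = p)
        exact h.1.not_pq (hC.split e (v := p) (by omega) (by have := h.1.pos; omega)).2
    · exact hwp e
  · rintro (e | ⟨e, -⟩)
    exacts [h.not_path hC e hw, h.ne e.symm]

/-- If the minimum gap is at least two, adding the edge across it creates more induced paths
than it destroys. -/
theorem p3Count_lt [DecidableRel E] (hT : TwoFree E) (hC : CircInterval n E)
    (h : IsMin n E s p q) (hd : 1 < cdist n p q) :
    p3Count n E < p3Count n (addEdge E p q) := by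
  have hlt : ∀ b, cdist n p b < n := fun b => (cdist_rebase p b b).1
  choose τ hτ using fun b => exists_cdist_eq q (hlt b)
  obtain ⟨x, hx⟩ : ∃ x, cdist n x p = 1 := by
    obtain ⟨x, hx⟩ := exists_cdist_eq p (k := n - 1) (by have := hlt p; omega)
    refine ⟨x, ?_⟩
    have a1 := cdist_rebase p x p
    have a2 := cdist_eq_zero.2 (rfl : p = p)
    have := hlt q
    omega
  have hxp : E x p := h.adj_of_dist_lt' hC (by omega) (by omega)
  have hxne : x ≠ p := by rintro rfl; exact hT.1 _ hxp
  have hmem : (x, p, q) ∈ (Finset.univ : Finset (Fin n × Fin n × Fin n)).filter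
      (fun t => InducedP3 (addEdge E p q) t.1 t.2.1 t.2.2) := by
    simpa using h.inducedP3_addEdge_left hT hC hxp
  unfold p3Count
  refine lt_of_le_of_lt (Finset.card_le_card_of_injOn
    (fun t => if t.1 = p ∧ t.2.2 = q then (p, q, τ t.2.1) else t) ?_ ?_)
    (Finset.card_erase_lt_of_mem hmem)
  · rintro ⟨a, b, c⟩ ht
    simp only [Finset.coe_filter, Finset.mem_univ, true_and, Set.mem_ofPred_eq] at ht
    simp only [Finset.coe_erase, Finset.coe_filter, Finset.mem_univ, true_and, Set.mem_sdiff,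
      Set.mem_ofPred_eq, Set.mem_singleton_iff]
    split_ifs with hac
    · obtain ⟨rfl, rfl⟩ := hac
      refine ⟨h.inducedP3_addEdge_right hT hC (h.adj_of_dist_lt hC ?_ ?_), ?_⟩
      · rw [hτ]
        exact cdist_pos.2 ht.1
      · rw [hτ]
        rcases lt_trichotomy (cdist n a b) (cdist n a c) with hb | hb | hb
        · exact hb
        · exact absurd (cdist_right_injective a hb) ht.2.1
        · exact absurd (hC.split ht.2.2.2.1 h.1.pos hb).1 h.1.not_pq
      · rintro e
        exact hxne (congrArg Prod.fst e).symm
    · refine ⟨h.inducedP3_addEdge_of_ne hC ht hac, ?_⟩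
      rintro e
      simp only [Prod.mk.injEq] at e
      obtain ⟨rfl, rfl, rfl⟩ := e
      exact h.1.not_pq ht.2.2.2.2.1
  · rintro ⟨a, b, c⟩ ht ⟨a', b', c'⟩ ht' heq
    simp only [Finset.coe_filter, Finset.mem_univ, true_and, Set.mem_ofPred_eq] at ht ht'
    simp only at heq
    split_ifs at heq with h1 h2 h2
    · obtain ⟨rfl, rfl⟩ := h1
      obtain ⟨rfl, rfl⟩ := h2
      simp only [Prod.mk.injEq, true_and] at heq
      have : cdist n a' b = cdist n a' b' := by rw [← hτ, ← hτ, heq]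
      rw [cdist_right_injective _ this]
    · simp only [Prod.mk.injEq] at heq
      obtain ⟨rfl, rfl, -⟩ := heq
      exact absurd ht'.2.2.2.1 h.1.not_pq
    · simp only [Prod.mk.injEq] at heq
      obtain ⟨rfl, rfl, -⟩ := heq
      exact absurd ht.2.2.2.1 h.1.not_pq
    · exact heq

theorem p3Count_le_of_eq_one [DecidableRel E] (hC : CircInterval n E)
    (h : IsMin n E s p q) (hd : cdist n p q = 1) :
    p3Count n E ≤ p3Count n (addEdge E p q) := by
  refine Finset.card_le_card fun ⟨a, b, c⟩ ht => ?_
  simp only [Finset.mem_filter, Finset.mem_univ, true_and] at ht ⊢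
  refine h.inducedP3_addEdge_of_ne hC ht ?_
  rintro ⟨rfl, rfl⟩
  have hab := cdist_pos.2 ht.1
  rcases lt_trichotomy (cdist n a b) (cdist n a c) with hb | hb | hb
  · omega
  · exact ht.2.1 (cdist_right_injective a hb)
  · exact h.1.not_pq (hC.split ht.2.2.2.1 h.1.pos hb).1

theorem xiCount_lt_of_eq_one [DecidableRel E] (h : IsMin n E s p q) (hd : cdist n p q = 1)
    {a b : Fin n} (hab : E a b) (hl : 1 < cdist n a b) :
    xiCount n (addEdge E p q) < xiCount n E := by
  refine Finset.card_lt_card (Finset.ssubset_iff_of_subset ?_ |>.2 ⟨(a, b, p, q), ?_, ?_⟩)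
  · rintro ⟨a, b, c, d⟩ ht
    simp only [Finset.mem_filter, Finset.mem_univ, true_and] at ht ⊢
    obtain ⟨e | ⟨rfl, rfl⟩, h1, h2, h3, h4⟩ := ht
    · exact ⟨e, h1, fun e => h2 (Or.inl e), fun e => h3 (Or.inl e), h4⟩
    · have := cdist_pos.2 h1
      omega
  · simp only [Finset.mem_filter, Finset.mem_univ, true_and]
    exact ⟨hab, h.ne, h.1.not_pq, h.1.not_qp, by omega⟩
  · simp only [Finset.mem_filter, Finset.mem_univ, true_and]
    exact fun ht => ht.2.2.1 (Or.inr ⟨rfl, rfl⟩)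

end IsMin

end StableTriple

section DirectedCycle

variable {n : ℕ}

theorem twoFree_directedCycle (hn : 4 ≤ n) : TwoFree (fun u v : Fin n => cdist n u v = 1) := by
  refine ⟨fun v h => ?_, fun u v h => ?_⟩
  · have := cdist_eq_zero.2 (rfl : v = v)
    omega
  · have := cdist_rebase u v u
    have := cdist_eq_zero.2 (rfl : u = u)
    omega

theorem circInterval_directedCycle : CircInterval n (fun u v : Fin n => cdist n u v = 1) := by
  intro u v w huv _ _ hlt e
  have := cdist_pos.2 huv
  omega

theorem inducedP3_directedCycle (hn : 4 ≤ n) {a b c : Fin n} (hab : cdist n a b = 1)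
    (hbc : cdist n b c = 1) : InducedP3 (fun u v : Fin n => cdist n u v = 1) a b c := by
  have h1 := cdist_rebase a b c
  have h2 := cdist_rebase a b a
  have h3 := cdist_rebase a c a
  have h4 := cdist_rebase a c b
  have h0 := cdist_eq_zero.2 (rfl : a = a)
  exact ⟨cdist_pos.1 (by omega), cdist_pos.1 (by omega), cdist_pos.1 (by omega), hab, hbc,
    by omega, by omega, by omega, by omega⟩

theorem p3Count_lt_directedCycle (hn : 4 ≤ n) {E : Fin n → Fin n → Prop} [DecidableRel E]
    (hE : ∀ a b, E a b → cdist n a b = 1) {p q : Fin n} (hpq : cdist n p q = 1)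
    (hne : ¬ E p q) : p3Count n E < p3Count n (fun u v : Fin n => cdist n u v = 1) := by
  obtain ⟨r, hr⟩ := exists_cdist_eq q (k := 1) (by omega)
  refine Finset.card_lt_card (Finset.ssubset_iff_of_subset ?_ |>.2 ⟨(p, q, r), ?_, ?_⟩)
  · rintro ⟨a, b, c⟩ ht
    simp only [Finset.mem_filter, Finset.mem_univ, true_and] at ht ⊢
    exact inducedP3_directedCycle hn (hE _ _ ht.2.2.2.1) (hE _ _ ht.2.2.2.2.1)
  · simp only [Finset.mem_filter, Finset.mem_univ, true_and]
    exact inducedP3_directedCycle hn hpq hr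
  · simp only [Finset.mem_filter, Finset.mem_univ, true_and]
    exact fun ht => hne ht.2.2.2.1

end DirectedCycle

theorem optimal_no_stable_triple (n : ℕ) (hn : 4 ≤ n)
    (E : Fin n → Fin n → Prop) [DecidableRel E] (hopt : Optimal n E) :
    ¬ ∃ u v w : Fin n, u ≠ v ∧ u ≠ w ∧ v ≠ w ∧
      ¬ E u v ∧ ¬ E v u ∧ ¬ E u w ∧ ¬ E w u ∧ ¬ E v w ∧ ¬ E w v := by
  rintro ⟨u, v, w, huv, huw, hvw, h1, h2, h3, h4, h5, h6⟩
  obtain ⟨s₀, p₀, q₀, h₀⟩ := StableTriple.exists_clockwise huv huw hvw h1 h2 h3 h4 h5 h6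
  obtain ⟨s, p, q, h⟩ := h₀.exists_isMin
  obtain ⟨hT, hC, hmax⟩ := hopt
  have hadd := hmax (addEdge E p q) inferInstance (h.twoFree_addEdge hT)
    (h.circInterval_addEdge hC)
  rcases (Nat.succ_le_of_lt h.1.pos).lt_or_eq with hd | hd
  · exact (h.p3Count_lt hT hC hd).not_ge hadd.1
  · have hxi := hadd.2 (hadd.1.antisymm (h.p3Count_le_of_eq_one hC hd.symm))
    have hshort : ∀ a b, E a b → cdist n a b = 1 := by
      intro a b hab
      have hpos : 0 < cdist n a b := cdist_pos.2 (by rintro rfl; exact hT.1 _ hab)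
      by_contra hl
      exact (h.xiCount_lt_of_eq_one hd.symm hab (by omega)).not_ge hxi
    exact (p3Count_lt_directedCycle hn hshort hd.symm h.1.not_pq).not_ge
      (hmax _ _ (twoFree_directedCycle hn) circInterval_directedCycle).1
end
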